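/- Let n ≥ 3 and let F be a triangle-intersecting family of subgraphs of the complete graph K_n with |F| = (1/8)·2^(C(n,2)). Then there is a triangle T ⊆ E_n such that F = {G ⊆ E_n : T ⊆ G}, i.e. F consists of all graphs containing a fixed triangle. -/

import Mathlib

/-- The edge set of the complete graph `K_n` on vertex set `Fin n`:
all non-diagonal unordered pairs. -/
def edgeFinset (n : ℕ) : Finset (Sym2 (Fin n)) :=
  Finset.univ.filter (fun e => ¬ e.IsDiag)

/-- `T` is a triangle: the three edges on three distinct vertices. -/
def IsTriangle {n : ℕ} (T : Finset (Sym2 (Fin n))) : Prop :=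
  ∃ a b c : Fin n, a ≠ b ∧ a ≠ c ∧ b ≠ c ∧ T = {s(a, b), s(a, c), s(b, c)}

/-- A family of graphs is triangle-intersecting if the intersection of any
two members contains a triangle. -/
def TriangleIntersecting {n : ℕ} (F : Finset (Finset (Sym2 (Fin n)))) : Prop :=
  ∀ G ∈ F, ∀ H ∈ F, ∃ T : Finset (Sym2 (Fin n)), IsTriangle T ∧ T ⊆ G ∩ H

/-- `C` is the set of words, as subsets of the ground set `S`, of a binary linear code whose
coordinates are not identically zero and pairwise distinguishable. -/
structure IsSimpleCode {α : Type*} [DecidableEq α] (S : Finset α) (C : Finset (Finset α)) :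
    Prop where
  subset : ∀ c ∈ C, c ⊆ S
  empty_mem : ∅ ∈ C
  symmDiff_mem : ∀ c ∈ C, ∀ d ∈ C, symmDiff c d ∈ C
  exists_mem : ∀ e ∈ S, ∃ c ∈ C, e ∈ c
  exists_separating : ∀ e ∈ S, ∀ f ∈ S, e ≠ f → ∃ c ∈ C, e ∈ c ∧ f ∉ c

/-- The number of words of weight `k`. -/
def weightCount {α : Type*} (C : Finset (Finset α)) (k : ℕ) : ℕ :=
  (C.filter (fun c => c.card = k)).card

lemma weightCount_add_le {α : Type*} (C : Finset (Finset α)) :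
    weightCount C 0 + weightCount C 1 + weightCount C 2 + weightCount C 4 ≤ C.card := by
  simp only [weightCount, Finset.card_filter, ← Finset.sum_add_distrib]
  rw [Finset.card_eq_sum_ones]
  refine Finset.sum_le_sum fun c _ => ?_
  split_ifs <;> omega

/-- The number of words of weight four that are orthogonal to all words. -/
def selfDualQuadCount {α : Type*} [DecidableEq α] (C : Finset (Finset α)) : ℕ :=
  (C.filter (fun c => c.card = 4 ∧ ∀ d ∈ C, Even (c ∩ d).card)).card

namespace IsSimpleCode

open Finset

variable {α : Type*} [DecidableEq α] {S : Finset α} {C : Finset (Finset α)}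

lemma card_symmDiff_add (c d : Finset α) :
    (symmDiff c d).card + 2 * (c ∩ d).card = c.card + d.card := by
  have h1 : symmDiff c d = (c \ d) ∪ (d \ c) := rfl
  have h2 : Disjoint (c \ d) (d \ c) := disjoint_sdiff_sdiff
  rw [h1, card_union_of_disjoint h2]
  have h3 := card_sdiff_add_card_inter c d
  have h4 := card_sdiff_add_card_inter d c
  rw [inter_comm d c] at h4
  omega

lemma two_mul_card_filter (h : IsSimpleCode S C) (P : Finset α → Prop) [DecidablePred P]
    {c₀ : Finset α} (hc₀ : c₀ ∈ C) (hP : ∀ c, P (symmDiff c c₀) ↔ ¬ P c) :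
    2 * (C.filter P).card = C.card := by
  have h1 : (C.filter P).card = (C.filter (fun c => ¬ P c)).card := by
    refine card_nbij' (fun c => symmDiff c c₀) (fun c => symmDiff c c₀) ?_ ?_ ?_ ?_
    · intro c hc
      simp only [coe_filter, Set.mem_ofPred_eq] at hc ⊢
      exact ⟨h.symmDiff_mem _ hc.1 _ hc₀, by rw [hP]; exact not_not.2 hc.2⟩
    · intro c hc
      simp only [coe_filter, Set.mem_ofPred_eq] at hc ⊢
      exact ⟨h.symmDiff_mem _ hc.1 _ hc₀, by rw [hP]; exact hc.2⟩
    · intro c _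
      exact symmDiff_symmDiff_cancel_right _ _
    · intro c _
      exact symmDiff_symmDiff_cancel_right _ _
  have h2 := card_filter_add_card_filter_not (s := C) P
  omega

lemma two_mul_card_mem (h : IsSimpleCode S C) {e : α} (he : e ∈ S) :
    2 * (C.filter (fun c => e ∈ c)).card = C.card := by
  obtain ⟨c₀, hc₀, hec⟩ := h.exists_mem e he
  refine h.two_mul_card_filter _ hc₀ fun c => ?_
  simp [mem_symmDiff, hec]

lemma four_mul_card_mem_mem (h : IsSimpleCode S C) {e f : α} (he : e ∈ S) (hf : f ∈ S)
    (hef : e ≠ f) : 4 * (C.filter (fun c => e ∈ c ∧ f ∈ c)).card = C.card := by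
  obtain ⟨c₀, hc₀, hec, hfc⟩ := h.exists_separating e he f hf hef
  have h1 := h.two_mul_card_mem he
  have h2 := h.two_mul_card_mem hf
  have h3 : 2 * (C.filter (fun c => ¬ (e ∈ c ↔ f ∈ c))).card = C.card := by
    refine h.two_mul_card_filter _ hc₀ fun c => ?_
    simp only [mem_symmDiff]
    tauto
  have h4 : (C.filter (fun c => e ∈ c)).card + (C.filter (fun c => f ∈ c)).card =
      (C.filter (fun c => ¬ (e ∈ c ↔ f ∈ c))).card +
        2 * (C.filter (fun c => e ∈ c ∧ f ∈ c)).card := by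
    simp only [card_filter, mul_sum, ← sum_add_distrib]
    refine sum_congr rfl fun c _ => ?_
    by_cases he : e ∈ c <;> by_cases hf : f ∈ c <;> simp [he, hf]
  omega

lemma two_mul_sum_card (h : IsSimpleCode S C) :
    2 * ∑ c ∈ C, c.card = C.card * S.card := by
  have h1 : ∑ c ∈ C, c.card = ∑ e ∈ S, (C.filter (fun c => e ∈ c)).card := by
    simp only [card_filter]
    rw [sum_comm]
    refine sum_congr rfl fun c hc => ?_
    rw [← card_filter, filter_mem_eq_inter, inter_eq_right.2 (h.subset c hc)]
  rw [h1, mul_sum, sum_congr rfl fun e he => h.two_mul_card_mem he]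
  simp [mul_comm]

lemma four_mul_sum_card_sq (h : IsSimpleCode S C) :
    4 * ∑ c ∈ C, c.card ^ 2 = C.card * (S.card * (S.card + 1)) := by
  have h1 : ∑ c ∈ C, c.card ^ 2 =
      ∑ e ∈ S, ∑ f ∈ S, (C.filter (fun c => e ∈ c ∧ f ∈ c)).card := by
    have h2 : ∀ c ∈ C, c.card ^ 2 = ∑ e ∈ S, ∑ f ∈ S, if e ∈ c ∧ f ∈ c then 1 else 0 := by
      intro c hc
      have h3 : c.card = ∑ e ∈ S, if e ∈ c then 1 else 0 := by
        rw [← card_filter, filter_mem_eq_inter, inter_eq_right.2 (h.subset c hc)]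
      rw [sq, h3, sum_mul_sum]
      simp [ite_and]
    rw [sum_congr rfl h2, sum_comm]
    refine sum_congr rfl fun e _ => ?_
    rw [sum_comm]
    simp only [card_filter]
  have h4 : ∀ e ∈ S, ∑ f ∈ S, 4 * (C.filter (fun c => e ∈ c ∧ f ∈ c)).card =
      C.card * (S.card + 1) := by
    intro e he
    rw [← add_sum_erase S _ he, sum_congr rfl fun f hf =>
      h.four_mul_card_mem_mem he (mem_of_mem_erase hf) (ne_of_mem_erase hf).symm]
    have h5 := h.two_mul_card_mem he
    have h6 : 0 < S.card := card_pos.2 ⟨e, he⟩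
    simp only [and_self, sum_const, card_erase_of_mem he, smul_eq_mul]
    obtain ⟨m, hm⟩ : ∃ m, S.card = m + 1 := ⟨S.card - 1, by omega⟩
    rw [hm, Nat.add_sub_cancel]
    linarith
  rw [h1, mul_sum]
  simp only [mul_sum]
  rw [sum_congr rfl h4]
  simp only [sum_const, smul_eq_mul]
  ring

lemma card_lt (h : IsSimpleCode S C) : S.card < C.card := by
  have hC : 0 < C.card := card_pos.2 ⟨∅, h.empty_mem⟩
  by_contra! hle
  have hS : 0 < S.card := by omega
  have h1 : (2 * ∑ c ∈ C, (c.card : ℤ)) = C.card * S.card := by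
    exact_mod_cast h.two_mul_sum_card
  have h2 : (4 * ∑ c ∈ C, (c.card : ℤ) ^ 2) = C.card * (S.card * (S.card + 1)) := by
    exact_mod_cast h.four_mul_sum_card_sq
  have h3 : 0 ≤ ∑ c ∈ C.erase ∅, (2 * ((C.card : ℤ) - 1) * c.card - C.card * S.card) ^ 2 :=
    sum_nonneg fun _ _ => sq_nonneg _
  have h4 := add_sum_erase C
    (fun c => (2 * ((C.card : ℤ) - 1) * c.card - C.card * S.card) ^ 2) h.empty_mem
  have h5 : ∑ c ∈ C, (2 * ((C.card : ℤ) - 1) * c.card - C.card * S.card) ^ 2 =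
      ((C.card : ℤ) - 1) ^ 2 * (4 * ∑ c ∈ C, (c.card : ℤ) ^ 2) -
        2 * ((C.card : ℤ) - 1) * (C.card * S.card) * (2 * ∑ c ∈ C, (c.card : ℤ)) +
        C.card * (C.card * S.card) ^ 2 := by
    have h6 : ∀ c ∈ C, (2 * ((C.card : ℤ) - 1) * c.card - C.card * S.card) ^ 2 =
        ((C.card : ℤ) - 1) ^ 2 * (4 * (c.card : ℤ) ^ 2) -
        2 * ((C.card : ℤ) - 1) * (C.card * S.card) * (2 * (c.card : ℤ)) +
        (C.card * S.card) ^ 2 := fun c _ => by ring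
    rw [sum_congr rfl h6, sum_add_distrib, sum_sub_distrib, ← mul_sum, ← mul_sum, ← mul_sum,
      ← mul_sum, sum_const, nsmul_eq_mul]
  simp only [card_empty] at h4
  rw [h5, h1, h2] at h4
  push_cast at h4
  have hC' : (1 : ℤ) ≤ C.card := by exact_mod_cast hC
  have hS' : (1 : ℤ) ≤ S.card := by exact_mod_cast hS
  have hle' : (C.card : ℤ) ≤ S.card := by exact_mod_cast hle
  have h7 : ∑ c ∈ C.erase ∅, (2 * ((C.card : ℤ) - 1) * c.card - C.card * S.card) ^ 2 =
      ((C.card : ℤ) * S.card) * (((C.card : ℤ) - 1) * (C.card - 1 - S.card)) := by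
    linear_combination h4
  rw [h7] at h3
  rcases hC'.eq_or_lt with h8 | h8
  · obtain ⟨e, he⟩ := card_pos.1 hS
    have h9 := h.two_mul_card_mem he
    have h10 : C.card = 1 := by exact_mod_cast h8.symm
    omega
  · have h9 : (0 : ℤ) < ((C.card : ℤ) * S.card) * (((C.card : ℤ) - 1) * (S.card + 1 - C.card)) := by
      have : (0 : ℤ) < (C.card : ℤ) - 1 := by linarith
      have : (0 : ℤ) < (S.card : ℤ) + 1 - C.card := by linarith
      have : (0 : ℤ) < C.card := by linarith
      have : (0 : ℤ) < S.card := by linarith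
      positivity
    nlinarith

lemma exists_basis (h : IsSimpleCode S C) :
    ∃ B ⊆ S, Set.InjOn (fun c => c ∩ B) C ∧ C.image (fun c => c ∩ B) = B.powerset := by
  obtain ⟨B, hB, hmin⟩ := exists_min_image
    (S.powerset.filter (fun B => ∀ c ∈ C, c ∩ B = ∅ → c = ∅)) card
    ⟨S, by
      simp only [mem_filter, mem_powerset, subset_refl, true_and]
      intro c hc hcS
      rwa [inter_eq_left.2 (h.subset c hc)] at hcS⟩
  simp only [mem_filter, mem_powerset] at hB hmin
  have hsymm : ∀ c d : Finset α, symmDiff c d ∩ B = symmDiff (c ∩ B) (d ∩ B) := fun c d => by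
    ext x; simp only [mem_inter, mem_symmDiff]; tauto
  refine ⟨B, hB.1, ?_, ?_⟩
  · intro c hc d hd hcd
    have h1 := hB.2 _ (h.symmDiff_mem c hc d hd) (by
      rw [hsymm, show c ∩ B = d ∩ B from hcd, symmDiff_self]; rfl)
    exact symmDiff_eq_bot.1 h1
  · have hsingle : ∀ b ∈ B, ∃ c ∈ C, c ∩ B = {b} := by
      intro b hb
      by_contra! hno
      have h1 := hmin (B.erase b) ⟨(erase_subset b B).trans hB.1, fun c hc hcb => by
        refine hB.2 c hc ?_
        by_contra hne
        refine hno c hc ?_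
        ext x
        have h2 : ∀ y, y ∈ c → y ∈ B → y = b := fun y hy hyB => by
          by_contra hyb
          have : y ∈ c ∩ B.erase b := by simp [hy, hyB, hyb]
          simp [hcb] at this
        obtain ⟨y, hy⟩ := nonempty_iff_ne_empty.2 hne
        rw [mem_inter] at hy
        have h3 := h2 y hy.1 hy.2
        subst h3
        simp only [mem_inter, mem_singleton]
        exact ⟨fun hx => h2 x hx.1 hx.2, fun hx => hx ▸ hy⟩⟩
      have h2 := card_erase_lt_of_mem hb
      omega
    ext T
    simp only [mem_image, mem_powerset]
    refine ⟨fun ⟨c, _, hc⟩ => hc ▸ inter_subset_right, ?_⟩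
    induction T using Finset.induction_on with
    | empty => exact fun _ => ⟨∅, h.empty_mem, by simp⟩
    | insert b T hbT ih =>
      intro hT
      obtain ⟨c, hc, hcT⟩ := ih ((subset_insert b T).trans hT)
      obtain ⟨d, hd, hdb⟩ := hsingle b (hT (mem_insert_self b T))
      refine ⟨symmDiff c d, h.symmDiff_mem c hc d hd, ?_⟩
      rw [hsymm, hcT, hdb]
      ext x
      simp only [mem_symmDiff, mem_singleton, mem_insert]
      by_cases hx : x = b
      · subst hx; simp [hbT]
      · simp [hx]

lemma mem_of_singletons {B : Finset α} (h : IsSimpleCode S C) (hB : ∀ b ∈ B, {b} ∈ C) :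
    ∀ T ⊆ B, T ∈ C := by
  intro T
  induction T using Finset.induction_on with
  | empty => exact fun _ => h.empty_mem
  | insert b T hbT ih =>
    intro hT
    have h1 := h.symmDiff_mem _ (hB b (hT (mem_insert_self b T))) _
      (ih ((subset_insert b T).trans hT))
    convert h1 using 1
    ext x
    simp only [mem_symmDiff, mem_singleton, mem_insert]
    by_cases hx : x = b
    · subst hx; simp [hbT]
    · simp [hx]

/-- Weight bounds coming from an information set of size `r`. -/
lemma exists_rank (h : IsSimpleCode S C) :
    ∃ r ≤ S.card, C.card = 2 ^ r ∧ weightCount C 1 ≤ r ∧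
      weightCount C 1 + weightCount C 2 ≤ r + r.choose 2 ∧
      (C = S.powerset ∨ weightCount C 1 < r) := by
  obtain ⟨B, hBS, hinj, himg⟩ := h.exists_basis
  have hne : ∀ c ∈ C, c ≠ ∅ → 0 < (c ∩ B).card := fun c hc hc0 => by
    rw [card_pos, nonempty_iff_ne_empty]
    intro h0
    exact hc0 (hinj hc h.empty_mem (by simp [h0]))
  have hsub : (C.filter (fun c => c.card = 1)).image (fun c => c ∩ B) ⊆ B.powersetCard 1 := by
    intro T hT
    simp only [mem_image, mem_filter] at hT
    obtain ⟨c, ⟨hc, hc1⟩, rfl⟩ := hT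
    have h1 := hne c hc (by rintro rfl; simp at hc1)
    have h2 := card_le_card (inter_subset_left : c ∩ B ⊆ c)
    rw [mem_powersetCard]
    exact ⟨inter_subset_right, by omega⟩
  have hcard : ((C.filter (fun c => c.card = 1)).image (fun c => c ∩ B)).card =
      weightCount C 1 :=
    card_image_of_injOn (hinj.mono (coe_subset.2 (filter_subset _ _)))
  have hle : weightCount C 1 ≤ B.card := by
    have := card_le_card hsub
    rwa [hcard, card_powersetCard, Nat.choose_one_right] at this
  refine ⟨B.card, card_le_card hBS, ?_, hle, ?_, ?_⟩
  · rw [← card_powerset, ← himg, card_image_of_injOn hinj]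
  · have h1 : weightCount C 1 + weightCount C 2 =
        (C.filter (fun c => c.card = 1 ∨ c.card = 2)).card := by
      rw [filter_or, card_union_of_disjoint]
      · rfl
      · refine disjoint_filter.2 fun c _ h1 h2 => ?_
        omega
    have h2 : B.card + B.card.choose 2 = (B.powersetCard 1 ∪ B.powersetCard 2).card := by
      rw [card_union_of_disjoint, card_powersetCard, card_powersetCard, Nat.choose_one_right]
      exact B.pairwise_disjoint_powersetCard (by decide)
    rw [h1, h2]
    refine card_le_card_of_injOn (fun c => c ∩ B) ?_ (hinj.mono (coe_subset.2 (filter_subset _ _)))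
    intro c hc
    simp only [coe_filter, Set.mem_ofPred_eq] at hc
    have h1 := hne c hc.1 (by rintro rfl; simp at hc)
    have h2 := card_le_card (inter_subset_left : c ∩ B ⊆ c)
    simp only [coe_union, Set.mem_union, mem_coe, mem_powersetCard, inter_subset_right, true_and]
    omega
  · rcases hle.lt_or_eq with hlt | heq
    · exact Or.inr hlt
    left
    have himg1 : (C.filter (fun c => c.card = 1)).image (fun c => c ∩ B) = B.powersetCard 1 :=
      eq_of_subset_of_card_le hsub (by simp [hcard, heq])
    have hsing : ∀ b ∈ B, {b} ∈ C := by
      intro b hb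
      have hb1 : ({b} : Finset α) ∈ B.powersetCard 1 := by simp [hb]
      rw [← himg1] at hb1
      simp only [mem_image, mem_filter] at hb1
      obtain ⟨c, ⟨hc, hc1⟩, hcb⟩ := hb1
      have h2 : {b} = c := eq_of_subset_of_card_le (hcb ▸ inter_subset_left) (by simp [hc1])
      exact h2 ▸ hc
    have hall := h.mem_of_singletons hsing
    have hinB : ∀ c ∈ C, c = c ∩ B := fun c hc =>
      hinj hc (hall _ inter_subset_right) (by simp)
    have hSB : S ⊆ B := by
      intro e he
      obtain ⟨c, hc, hec⟩ := h.exists_mem e he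
      rw [hinB c hc] at hec
      exact (mem_inter.1 hec).2
    ext T
    exact ⟨fun hT => mem_powerset.2 (h.subset T hT),
      fun hT => hall T ((mem_powerset.1 hT).trans hSB)⟩

lemma sum_comp_card (h : IsSimpleCode S C) (f : ℕ → ℕ) :
    ∑ c ∈ C, f c.card = ∑ k ∈ range (S.card + 1), weightCount C k * f k := by
  rw [← sum_fiberwise_of_maps_to (t := range (S.card + 1)) (g := card)
    (fun c hc => mem_range.2 (Nat.lt_succ_of_le (card_le_card (h.subset c hc))))]
  refine sum_congr rfl fun k _ => ?_
  rw [sum_congr rfl (g := fun _ => f k) fun c hc => by rw [(mem_filter.1 hc).2]]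
  simp [weightCount]

lemma weightCount_zero (h : IsSimpleCode S C) : weightCount C 0 = 1 := by
  rw [weightCount, card_eq_one]
  refine ⟨∅, ?_⟩
  ext c
  simp only [mem_filter, card_eq_zero, mem_singleton]
  exact ⟨fun hc => hc.2, fun hc => ⟨hc ▸ h.empty_mem, hc⟩⟩

lemma weightCount_eq_zero (h : IsSimpleCode S C) {k : ℕ} (hk : S.card < k) :
    weightCount C k = 0 := by
  rw [weightCount, card_eq_zero, filter_eq_empty_iff]
  intro c hc hck
  have := card_le_card (h.subset c hc)
  omega

lemma selfDualQuadCount_le : selfDualQuadCount C ≤ weightCount C 4 :=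
  card_le_card (monotone_filter_right C fun _ _ hc => hc.1)

lemma two_mul_weightCount_one_add_three (h : IsSimpleCode S C) :
    2 * (weightCount C 1 + weightCount C 3) ≤ C.card := by
  have h1 : weightCount C 1 + weightCount C 3 ≤ (C.filter (fun c => Odd c.card)).card := by
    rw [weightCount, weightCount, ← card_union_of_disjoint]
    · refine card_le_card fun c hc => ?_
      simp only [mem_union, mem_filter] at hc ⊢
      rcases hc with ⟨hc, h1⟩ | ⟨hc, h1⟩ <;> exact ⟨hc, h1 ▸ by decide⟩
    · refine disjoint_filter.2 fun c _ h1 h2 => ?_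
      omega
  rcases (C.filter (fun c => Odd c.card)).eq_empty_or_nonempty with h0 | ⟨c₀, hc₀⟩
  · rw [h0, card_empty] at h1
    omega
  · rw [mem_filter] at hc₀
    have := h.two_mul_card_filter (fun c => Odd c.card) hc₀.1 fun c => by
      have h2 := card_symmDiff_add c c₀
      have h3 := hc₀.2
      simp only [Nat.odd_iff] at h3 ⊢
      omega
    omega

lemma selfDualQuadCount_pos (h : IsSimpleCode S C) (h1 : weightCount C 1 = 0)
    (h4 : weightCount C 4 = 1) (h5 : weightCount C 5 = 0) (hS : S.card = 5) :
    0 < selfDualQuadCount C := by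
  obtain ⟨c, hc⟩ := card_eq_one.1 h4
  have hmem : ∀ d, d ∈ C → d.card = 4 → d = c := fun d hd hd4 => by
    rw [← mem_singleton, ← hc, mem_filter]
    exact ⟨hd, hd4⟩
  have hcC : c ∈ C ∧ c.card = 4 := by
    rw [← mem_filter (p := fun c : Finset α => c.card = 4), hc]
    exact mem_singleton_self c
  have hne : ∀ k, weightCount C k = 0 → ∀ d ∈ C, d.card ≠ k := fun k hk d hd hdk => by
    rw [weightCount, card_eq_zero, filter_eq_empty_iff] at hk
    exact hk hd hdk
  rw [selfDualQuadCount, card_pos]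
  refine ⟨c, mem_filter.2 ⟨hcC.1, hcC.2, fun d hd => ?_⟩⟩
  have hcd := h.symmDiff_mem c hcC.1 d hd
  have e1 := card_symmDiff_add c d
  have e2 := card_le_card (h.subset d hd)
  have e3 := hne 1 h1 d hd
  have e4 := hne 5 h5 d hd
  have e5 := hne 1 h1 _ hcd
  have e6 := hne 5 h5 _ hcd
  have e7 := card_le_card (h.subset _ hcd)
  have e8 : d.card = 0 → (c ∩ d).card = 0 := fun h0 => by
    rw [card_eq_zero.1 h0, inter_empty, card_empty]
  have e9 : d.card = 4 → (c ∩ d).card = 4 := fun h0 => by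
    rw [hmem d hd h0, inter_self, hcC.2]
  have e10 : (symmDiff c d).card = 4 → d.card = 0 := fun h0 => by
    have e11 := hmem _ hcd h0
    rw [symmDiff_eq_left] at e11
    rw [e11]; rfl
  have e12 : (symmDiff c d).card = 0 → d.card = 4 := fun h0 => by
    have e11 := card_eq_zero.1 h0
    rw [← symmDiff_eq_bot.1 e11, hcC.2]
  rw [Nat.even_iff]
  omega

theorem odd_bound (h : IsSimpleCode S C) (hS : Odd S.card) :
    56 + 6 * weightCount C 3 ≤ 8 * C.card + 40 * weightCount C 1 + 8 * weightCount C 2 +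
      selfDualQuadCount C ∧
    (3 < S.card → 56 + 6 * weightCount C 3 < 8 * C.card + 40 * weightCount C 1 +
      8 * weightCount C 2 + selfDualQuadCount C) := by
  obtain ⟨r, hr, hC, -⟩ := h.exists_rank
  have hlt := h.card_lt
  rcases le_or_gt 4 r with h4 | h4
  · have h1 := h.two_mul_weightCount_one_add_three
    have h2 : 2 ^ 4 ≤ C.card := hC ▸ Nat.pow_le_pow_right (by norm_num) h4
    omega
  have e0 := h.weightCount_zero
  have e1 := h.sum_comp_card (fun _ => 1)
  have e2 := h.sum_comp_card id
  have e3 := h.sum_comp_card (· ^ 2)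
  have e4 := h.two_mul_sum_card
  have e5 := h.four_mul_sum_card_sq
  have e6 := h.selfDualQuadCount_pos
  have e7 := fun k (hk : S.card < k) => h.weightCount_eq_zero hk
  rw [Nat.odd_iff] at hS
  have hm : r = 1 ∧ S.card = 1 ∨ r = 2 ∧ S.card = 3 ∨ r = 3 ∧ S.card = 3 ∨
      r = 3 ∧ S.card = 5 ∨ r = 3 ∧ S.card = 7 := by
    interval_cases r <;> omega
  simp only [id_eq] at e2
  simp only [sum_const, smul_eq_mul, mul_one] at e1
  rcases hm with ⟨rfl, hm⟩ | ⟨rfl, hm⟩ | ⟨rfl, hm⟩ | ⟨rfl, hm⟩ | ⟨rfl, hm⟩ <;>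
    rw [hm] at e1 e2 e3 e4 e5 ⊢ <;>
    rw [hC] at e1 e4 e5 ⊢ <;>
    norm_num [sum_range_succ] at e1 e2 e3 e4 e5 ⊢
  · have := e7 3 (by omega)
    omega
  · omega
  · omega
  · have := e6 (by omega) (by omega) (by omega) hm
    omega
  · omega

theorem even_bound (h : IsSimpleCode S C) (hS : Even S.card) :
    40 * weightCount C 1 + 8 * weightCount C 2 + selfDualQuadCount C ≤
      56 + 8 * C.card + 6 * weightCount C 3 ∧
    (C ≠ S.powerset → 40 * weightCount C 1 + 8 * weightCount C 2 + selfDualQuadCount C <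
      56 + 8 * C.card + 6 * weightCount C 3) := by
  obtain ⟨r, hr, hC, hA1, hA2, hfree⟩ := h.exists_rank
  have hlt := h.card_lt
  have h1 := weightCount_add_le C
  rw [h.weightCount_zero] at h1
  have h2 := selfDualQuadCount_le (C := C)
  rw [Nat.even_iff] at hS
  rcases le_or_gt 5 r with h5 | h5
  · have h3 : 39 * r + 7 * r.choose 2 < 57 + 7 * 2 ^ r ∧ 39 + 7 * r ≤ 7 * 2 ^ r := by
      clear * - h5
      induction r, h5 using Nat.le_induction with
      | base => decide
      | succ k hk ih =>
        rw [Nat.choose_succ_succ' k 1, Nat.choose_one_right, pow_succ, one_add_one_eq_two]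
        omega
    omega
  have hlarge : r < S.card → weightCount C 1 < r →
      40 * weightCount C 1 + 8 * weightCount C 2 + selfDualQuadCount C <
      56 + 8 * C.card + 6 * weightCount C 3 := by
    intro h3 h4
    interval_cases r <;> simp [Nat.choose] at hA2 <;> omega
  by_cases hfull : C = S.powerset
  · refine ⟨?_, fun hne => absurd hfull hne⟩
    have hw : ∀ k, weightCount C k = S.card.choose k := fun k => by
      rw [weightCount, hfull, ← powersetCard_eq_filter, card_powersetCard]
    have hD : selfDualQuadCount C = 0 := by
      rw [selfDualQuadCount, card_eq_zero, filter_eq_empty_iff]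
      rintro c hc ⟨hc4, hev⟩
      obtain ⟨e, he⟩ : c.Nonempty := card_pos.1 (by omega)
      have := hev {e} (by rw [hfull, mem_powerset, singleton_subset_iff]; exact h.subset c hc he)
      rw [inter_singleton_of_mem he, card_singleton] at this
      exact absurd this (by decide)
    have hCr : S.card = r := by
      rw [hfull, card_powerset] at hC
      exact Nat.pow_right_injective le_rfl hC
    rw [hw, hw, hw, hD, hC, hCr]
    rw [hCr] at hS
    interval_cases r <;> first | omega | simp [Nat.choose]
  · have h3 := hfree.resolve_left hfull
    have h4 : r < S.card := by
      refine lt_of_le_of_ne hr fun hrS => hfull ?_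
      refine eq_of_subset_of_card_le (fun c hc => mem_powerset.2 (h.subset c hc)) ?_
      rw [card_powerset, hC, hrS]
    exact ⟨(hlarge h4 h3).le, fun _ => hlarge h4 h3⟩

end IsSimpleCode

section Fourier

open Finset

variable {α : Type*} [DecidableEq α]

/-- The unnormalised Fourier coefficient of the family `F` at `S`. -/
def fourierSum (F : Finset (Finset α)) (S : Finset α) : ℤ :=
  ∑ G ∈ F, (-1) ^ (S ∩ G).card

lemma neg_one_pow_card_inter (S G : Finset α) :
    (-1 : ℤ) ^ (S ∩ G).card = ∏ e ∈ S, if e ∈ G then -1 else 1 := by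
  rw [prod_ite, prod_const, prod_const_one, mul_one, filter_mem_eq_inter]

lemma sum_powerset_neg_one_pow_mul (U G H D : Finset α) :
    ∑ S ∈ U.powerset, (-1 : ℤ) ^ (S ∩ D).card * (-1) ^ (S ∩ G).card * (-1) ^ (S ∩ H).card =
      if symmDiff G H ∩ U = D ∩ U then 2 ^ U.card else 0 := by
  simp only [neg_one_pow_card_inter, ← prod_mul_distrib]
  rw [← prod_one_add]
  split_ifs with h
  · rw [← prod_const]
    refine prod_congr rfl fun e he => ?_
    have h1 : e ∈ symmDiff G H ↔ e ∈ D := by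
      have := congrArg (e ∈ ·) h
      simpa [he] using this
    rw [mem_symmDiff] at h1
    by_cases hG : e ∈ G <;> by_cases hH : e ∈ H <;> simp_all
  · obtain ⟨e, he⟩ : ∃ e, ¬ (e ∈ symmDiff G H ∩ U ↔ e ∈ D ∩ U) := by
      by_contra! hall
      exact h (Finset.ext hall)
    have heU : e ∈ U := by
      by_contra hU
      simp [hU] at he
    refine prod_eq_zero heU ?_
    simp only [mem_inter, heU, and_true, mem_symmDiff] at he
    by_cases hG : e ∈ G <;> by_cases hH : e ∈ H <;> by_cases hD : e ∈ D <;> simp_all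

lemma sum_mul_fourierSum_sq (F : Finset (Finset α)) (U D : Finset α) :
    ∑ S ∈ U.powerset, (-1) ^ (S ∩ D).card * fourierSum F S ^ 2 =
      ∑ G ∈ F, ∑ H ∈ F, if symmDiff G H ∩ U = D ∩ U then 2 ^ U.card else 0 := by
  simp only [← sum_powerset_neg_one_pow_mul]
  have h1 : ∀ S, (-1) ^ (S ∩ D).card * fourierSum F S ^ 2 = ∑ G ∈ F, ∑ H ∈ F,
      (-1 : ℤ) ^ (S ∩ D).card * (-1) ^ (S ∩ G).card * (-1) ^ (S ∩ H).card := fun S => by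
    rw [sq, fourierSum, sum_mul_sum, mul_sum]
    refine sum_congr rfl fun G _ => ?_
    rw [mul_sum]
    exact sum_congr rfl fun H _ => (mul_assoc _ _ _).symm
  simp only [h1]
  rw [sum_comm]
  exact sum_congr rfl fun G _ => sum_comm

lemma sum_fourierSum_sq {F : Finset (Finset α)} {U : Finset α} (hF : F ⊆ U.powerset) :
    ∑ S ∈ U.powerset, fourierSum F S ^ 2 = F.card * 2 ^ U.card := by
  have h1 := sum_mul_fourierSum_sq F U ∅
  simp only [inter_empty, card_empty, pow_zero, one_mul, empty_inter] at h1
  have h2 : ∀ G ∈ F, (∑ H ∈ F, if symmDiff G H ∩ U = ∅ then (2 : ℤ) ^ U.card else 0) =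
      2 ^ U.card := by
    intro G hG
    rw [sum_eq_single_of_mem G hG]
    · rw [symmDiff_self, if_pos]
      exact bot_inf_eq _
    · intro H hH hHG
      rw [if_neg]
      intro h0
      have hsub : symmDiff G H ⊆ U := fun e he => by
        rw [mem_symmDiff] at he
        rcases he with he | he
        · exact mem_powerset.1 (hF hG) he.1
        · exact mem_powerset.1 (hF hH) he.1
      rw [inter_eq_left.2 hsub] at h0
      exact hHG (symmDiff_eq_bot.1 h0).symm
  rw [h1, sum_congr rfl h2, sum_const, nsmul_eq_mul]

lemma fourierSum_empty (F : Finset (Finset α)) : fourierSum F ∅ = F.card := by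
  simp [fourierSum]

/-- Functions of the trace `S ∩ B`, twisted by the parity of `S`, integrate to zero against the
squared Fourier transform of a family without differences `G ∆ H` equal to `U` minus a subset of `B`. -/
lemma sum_trace_mul_fourierSum_sq {F : Finset (Finset α)} {U B : Finset α}
    (hFB : ∀ G ∈ F, ∀ H ∈ F, ∀ B' ⊆ B, symmDiff G H ∩ U ≠ U \ B') (g : Finset α → ℤ) :
    ∑ S ∈ U.powerset, (-1) ^ S.card * g (S ∩ B) * fourierSum F S ^ 2 = 0 := by
  have hsplit : ∀ S ∈ U.powerset, ∀ B' ⊆ B,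
      (-1 : ℤ) ^ (S ∩ (U \ B')).card = (-1) ^ S.card * (-1) ^ (B' ∩ S).card := by
    intro S hS B' hB'
    rw [mem_powerset] at hS
    have h1 : S ∩ (U \ B') = S \ B' := by
      ext e
      simp only [mem_inter, mem_sdiff]
      exact ⟨fun h => ⟨h.1, h.2.2⟩, fun h => ⟨h.1, hS h.1, h.2⟩⟩
    rw [h1, ← card_sdiff_add_card_inter S B', inter_comm B', pow_add, mul_assoc,
      ← mul_pow]
    simp
  have hzero : ∀ B' ⊆ B,
      ∑ S ∈ U.powerset, (-1) ^ S.card * (-1) ^ (B' ∩ S).card * fourierSum F S ^ 2 = 0 := by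
    intro B' hB'
    have h1 := sum_mul_fourierSum_sq F U (U \ B')
    rw [sum_congr rfl fun S hS => by rw [hsplit S hS B' hB']] at h1
    rw [h1]
    refine sum_eq_zero fun G hG => sum_eq_zero fun H hH => if_neg ?_
    rw [inter_eq_left.2 (sdiff_subset : U \ B' ⊆ U)]
    exact hFB G hG H hH B' hB'
  have hind : ∀ S, 2 ^ B.card * g (S ∩ B) = ∑ R ∈ B.powerset, g R *
      ∑ B' ∈ B.powerset, (-1) ^ (B' ∩ R).card * (-1) ^ (B' ∩ S).card := by
    intro S
    have h1 := fun R => sum_powerset_neg_one_pow_mul B R S ∅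
    simp only [inter_empty, card_empty, pow_zero, one_mul, empty_inter] at h1
    simp only [h1]
    rw [sum_eq_single_of_mem (S ∩ B) (by simp), if_pos, mul_comm]
    · ext e; simp only [mem_inter, mem_symmDiff, notMem_empty, iff_false]; tauto
    · intro R hR hRS
      rw [if_neg, mul_zero]
      intro h0
      refine hRS ?_
      ext e
      have h2 := congrArg (e ∈ ·) h0
      have h3 : e ∈ R → e ∈ B := fun h => mem_powerset.1 hR h
      simp only [mem_inter, mem_symmDiff, notMem_empty, eq_iff_iff, iff_false] at h2 ⊢
      tauto
  have hmul : 2 ^ B.card *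
      ∑ S ∈ U.powerset, (-1) ^ S.card * g (S ∩ B) * fourierSum F S ^ 2 = 0 := by
    have h1 : ∀ S, 2 ^ B.card * ((-1) ^ S.card * g (S ∩ B) * fourierSum F S ^ 2) =
        ∑ R ∈ B.powerset, ∑ B' ∈ B.powerset, g R * (-1) ^ (B' ∩ R).card *
          ((-1) ^ S.card * (-1) ^ (B' ∩ S).card * fourierSum F S ^ 2) := by
      intro S
      rw [show 2 ^ B.card * ((-1) ^ S.card * g (S ∩ B) * fourierSum F S ^ 2) =
        (2 ^ B.card * g (S ∩ B)) * ((-1) ^ S.card * fourierSum F S ^ 2) by ring, hind, sum_mul]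
      refine sum_congr rfl fun R _ => ?_
      rw [mul_sum, sum_mul]
      exact sum_congr rfl fun B' _ => by ring
    rw [mul_sum, sum_congr rfl fun S _ => h1 S, sum_comm]
    refine sum_eq_zero fun R _ => ?_
    rw [sum_comm]
    refine sum_eq_zero fun B' hB' => ?_
    rw [← mul_sum, hzero B' (mem_powerset.1 hB'), mul_zero]
  exact (mul_eq_zero.1 hmul).resolve_left (by positivity)

/-- A minimal member of a family is contained in a set of its Fourier support. -/
lemma exists_superset_fourierSum_ne_zero {F : Finset (Finset α)} {U M : Finset α}
    (hF : F ⊆ U.powerset) (hM : M ∈ F) (hmin : ∀ G ∈ F, G ⊆ M → G = M) :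
    ∃ S, M ⊆ S ∧ S ⊆ U ∧ fourierSum F S ≠ 0 := by
  have hMU := mem_powerset.1 (hF hM)
  by_contra! hno
  have h1 : ∑ R ∈ (U \ M).powerset, fourierSum F (M ∪ R) = 0 :=
    sum_eq_zero fun R hR => hno _ subset_union_left
      (union_subset hMU ((mem_powerset.1 hR).trans sdiff_subset))
  have h2 : ∀ G, ∑ R ∈ (U \ M).powerset, (-1 : ℤ) ^ ((M ∪ R) ∩ G).card =
      (-1) ^ (M ∩ G).card * ∏ e ∈ U \ M, (1 + if e ∈ G then -1 else 1) := by
    intro G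
    rw [prod_one_add, mul_sum]
    refine sum_congr rfl fun R hR => ?_
    rw [neg_one_pow_card_inter, neg_one_pow_card_inter, prod_union]
    exact disjoint_of_subset_right (mem_powerset.1 hR) disjoint_sdiff
  simp only [fourierSum] at h1
  rw [sum_comm, sum_congr rfl fun G _ => h2 G, sum_eq_single_of_mem M hM] at h1
  · rw [prod_congr rfl (g := fun _ => (2 : ℤ))] at h1
    · simp at h1
    · intro e he
      rw [if_neg (mem_sdiff.1 he).2]
      norm_num
  · intro G hG hGM
    obtain ⟨e, he, heM⟩ := not_subset.1 fun hsub => hGM (hmin G hG hsub)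
    rw [prod_eq_zero (i := e), mul_zero]
    · exact mem_sdiff.2 ⟨mem_powerset.1 (hF hG) he, heM⟩
    · simp [he]

end Fourier

section Cuts

open Finset

variable {n : ℕ}

/-- The edges joining `X` to its complement. -/
def cut (X : Finset (Fin n)) : Finset (Sym2 (Fin n)) :=
  univ.filter (fun e => ∃ a ∈ X, ∃ b ∉ X, e = s(a, b))

lemma mk_mem_cut {X : Finset (Fin n)} {a b : Fin n} :
    s(a, b) ∈ cut X ↔ ¬ (a ∈ X ↔ b ∈ X) := by
  simp only [cut, mem_filter, mem_univ, true_and, Sym2.eq_iff]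
  constructor
  · rintro ⟨c, hc, d, hd, ⟨rfl, rfl⟩ | ⟨rfl, rfl⟩⟩ <;> tauto
  · intro h
    by_cases ha : a ∈ X
    · exact ⟨a, ha, b, by tauto, Or.inl ⟨rfl, rfl⟩⟩
    · exact ⟨b, by tauto, a, ha, Or.inr ⟨rfl, rfl⟩⟩

lemma cut_symmDiff (X Y : Finset (Fin n)) : cut (symmDiff X Y) = symmDiff (cut X) (cut Y) := by
  ext e
  induction e using Sym2.ind with
  | _ a b =>
    simp only [mem_symmDiff, mk_mem_cut]
    tauto

lemma IsTriangle.card_eq {T : Finset (Sym2 (Fin n))} (hT : IsTriangle T) : T.card = 3 := by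
  obtain ⟨a, b, c, hab, hac, hbc, rfl⟩ := hT
  rw [card_eq_three]
  refine ⟨_, _, _, ?_, ?_, ?_, rfl⟩ <;> simp only [ne_eq, Sym2.eq_iff] <;> grind

lemma IsTriangle.even_card_inter_cut {T : Finset (Sym2 (Fin n))} (hT : IsTriangle T)
    (X : Finset (Fin n)) : Even (T ∩ cut X).card := by
  obtain ⟨a, b, c, hab, hac, hbc, rfl⟩ := hT
  have h1 : s(a, b) ≠ s(a, c) := by simp only [ne_eq, Sym2.eq_iff]; grind
  have h2 : s(a, b) ≠ s(b, c) := by simp only [ne_eq, Sym2.eq_iff]; grind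
  have h3 : s(a, c) ≠ s(b, c) := by simp only [ne_eq, Sym2.eq_iff]; grind
  rw [← filter_mem_eq_inter, card_filter, sum_insert (by simp [h1, h2]), sum_insert (by simp [h3]),
    sum_singleton]
  simp only [mk_mem_cut]
  by_cases ha : a ∈ X <;> by_cases hb : b ∈ X <;> by_cases hc : c ∈ X <;> simp [ha, hb, hc]

lemma IsTriangle.not_subset_cut {T : Finset (Sym2 (Fin n))} (hT : IsTriangle T)
    (X : Finset (Fin n)) : ¬ T ⊆ cut X := by
  intro h
  have h1 := hT.even_card_inter_cut X
  rw [inter_eq_left.2 h, hT.card_eq] at h1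
  exact absurd h1 (by decide)

/-- The traces on `S` of all cuts. -/
def cutCode (S : Finset (Sym2 (Fin n))) : Finset (Finset (Sym2 (Fin n))) :=
  univ.image (fun X => S ∩ cut X)

lemma inter_cut_symmDiff (S : Finset (Sym2 (Fin n))) (X Y : Finset (Fin n)) :
    S ∩ cut (symmDiff X Y) = symmDiff (S ∩ cut X) (S ∩ cut Y) := by
  rw [cut_symmDiff]
  ext e
  simp only [mem_inter, mem_symmDiff]
  tauto

lemma cut_empty : cut (∅ : Finset (Fin n)) = ∅ := by
  simp [cut]

lemma isSimpleCode_cutCode {S : Finset (Sym2 (Fin n))} (hS : S ⊆ edgeFinset n) :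
    IsSimpleCode S (cutCode S) where
  subset c hc := by
    obtain ⟨X, -, rfl⟩ := mem_image.1 hc
    exact inter_subset_left
  empty_mem := mem_image.2 ⟨∅, mem_univ _, by rw [cut_empty, inter_empty]⟩
  symmDiff_mem c hc d hd := by
    obtain ⟨X, -, rfl⟩ := mem_image.1 hc
    obtain ⟨Y, -, rfl⟩ := mem_image.1 hd
    exact mem_image.2 ⟨symmDiff X Y, mem_univ _, inter_cut_symmDiff S X Y⟩
  exists_mem e he := by
    have h1 := hS he
    induction e using Sym2.ind with
    | _ a b =>
      simp only [edgeFinset, mem_filter, Sym2.mk_isDiag_iff, mem_univ, true_and] at h1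
      refine ⟨S ∩ cut {a}, mem_image_of_mem _ (mem_univ _), mem_inter.2 ⟨he, ?_⟩⟩
      simp [mk_mem_cut, Ne.symm h1]
  exists_separating e he f hf hef := by
    have h1 := hS he
    have h2 := hS hf
    induction e using Sym2.ind with
    | _ a b =>
    induction f using Sym2.ind with
    | _ c d =>
      simp only [edgeFinset, mem_filter, Sym2.mk_isDiag_iff, mem_univ, true_and] at h1 h2
      simp only [ne_eq, Sym2.eq_iff] at hef
      by_cases h3 : a = c ∨ a = d
      · refine ⟨S ∩ cut {b}, mem_image_of_mem _ (mem_univ _), mem_inter.2 ⟨he, ?_⟩,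
          fun h => absurd (mem_inter.1 h).2 ?_⟩ <;>
          simp only [mk_mem_cut, mem_singleton] <;> grind
      · refine ⟨S ∩ cut {a}, mem_image_of_mem _ (mem_univ _), mem_inter.2 ⟨he, ?_⟩,
          fun h => absurd (mem_inter.1 h).2 ?_⟩ <;>
          simp only [mk_mem_cut, mem_singleton] <;> grind

lemma exists_sum_inter_cut (S : Finset (Sym2 (Fin n))) :
    ∃ K : ℕ, 0 < K ∧ 2 ^ n = K * (cutCode S).card ∧ ∀ g : Finset (Sym2 (Fin n)) → ℤ,
      ∑ X : Finset (Fin n), g (S ∩ cut X) = K * ∑ c ∈ cutCode S, g c := by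
  set K := (univ.filter (fun X : Finset (Fin n) => S ∩ cut X = ∅)).card with hK
  have hfib : ∀ c ∈ cutCode S,
      (univ.filter (fun X : Finset (Fin n) => S ∩ cut X = c)).card = K := by
    intro c hc
    obtain ⟨Y, -, rfl⟩ := mem_image.1 hc
    refine card_nbij' (fun X => symmDiff X Y) (fun X => symmDiff X Y) ?_ ?_ ?_ ?_
    · intro X hX
      simp only [coe_filter, mem_univ, true_and, Set.mem_ofPred_eq] at hX ⊢
      rw [inter_cut_symmDiff, hX, symmDiff_self]
      rfl
    · intro X hX
      simp only [coe_filter, mem_univ, true_and, Set.mem_ofPred_eq] at hX ⊢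
      rw [inter_cut_symmDiff, hX]
      exact bot_symmDiff _
    · intro X _
      exact symmDiff_symmDiff_cancel_right _ _
    · intro X _
      exact symmDiff_symmDiff_cancel_right _ _
  have hsum : ∀ g : Finset (Sym2 (Fin n)) → ℤ,
      ∑ X : Finset (Fin n), g (S ∩ cut X) = K * ∑ c ∈ cutCode S, g c := by
    intro g
    rw [sum_comp g (fun X : Finset (Fin n) => S ∩ cut X), mul_sum]
    refine sum_congr rfl fun c hc => ?_
    rw [hfib c hc, nsmul_eq_mul]
  refine ⟨K, ?_, ?_, hsum⟩
  · exact card_pos.2 ⟨∅, by simp [cut_empty]⟩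
  · have h1 := hsum (fun _ => 1)
    simp only [sum_const, card_univ, Fintype.card_finset, Fintype.card_fin, nsmul_eq_mul,
      mul_one] at h1
    exact_mod_cast h1

/-- The weight given to the trace of a graph on a cut. -/
def cutWeight (R : Finset (Sym2 (Fin n))) : ℤ :=
  (if R.card = 0 then 56 else 0) - (if R.card = 1 then 40 else 0) -
    (if R.card = 2 then 8 else 0) + (if R.card = 3 then 6 else 0) -
    (if R.card = 4 ∧ ∀ Y : Finset (Fin n), Even (R ∩ cut Y).card then 1 else 0)

lemma sum_cutWeight {S : Finset (Sym2 (Fin n))} (hS : S ⊆ edgeFinset n) :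
    ∑ c ∈ cutCode S, cutWeight c = 56 - 40 * (weightCount (cutCode S) 1 : ℤ) -
      8 * weightCount (cutCode S) 2 + 6 * weightCount (cutCode S) 3 -
      selfDualQuadCount (cutCode S) := by
  have h := isSimpleCode_cutCode hS
  have h0 := h.weightCount_zero
  have h4 : (cutCode S).filter (fun c => c.card = 4 ∧
      ∀ Y : Finset (Fin n), Even (c ∩ cut Y).card) =
      (cutCode S).filter (fun c => c.card = 4 ∧ ∀ d ∈ cutCode S, Even (c ∩ d).card) := by
    refine filter_congr fun c hc => and_congr_right fun _ => ?_
    have h5 : ∀ Y : Finset (Fin n), c ∩ (S ∩ cut Y) = c ∩ cut Y := fun Y => by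
      rw [← inter_assoc, inter_eq_left.2 (h.subset c hc)]
    simp only [cutCode, mem_image, mem_univ, true_and, forall_exists_index,
      forall_apply_eq_imp_iff, h5]
  simp only [weightCount] at h0
  simp only [cutWeight, sum_add_distrib, sum_sub_distrib, ← sum_filter, sum_const, h4, h0,
    nsmul_eq_mul, weightCount, selfDualQuadCount]
  push_cast
  ring_nf

/-- The signed sum of `cutWeight` over all cuts is the (rescaled) eigenvalue at `S`; its minimum
is attained, among graphs containing a triangle, by the triangles only. -/
lemma signed_sum_cutWeight {S : Finset (Sym2 (Fin n))} (hS : S ⊆ edgeFinset n) :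
    0 ≤ 8 * 2 ^ n + (-1) ^ S.card * ∑ X : Finset (Fin n), cutWeight (S ∩ cut X) ∧
    ((∃ T ⊆ S, IsTriangle T) → 3 < S.card →
      0 < 8 * 2 ^ n + (-1) ^ S.card * ∑ X : Finset (Fin n), cutWeight (S ∩ cut X)) := by
  obtain ⟨K, hK, hKn, hsum⟩ := exists_sum_inter_cut S
  have h := isSimpleCode_cutCode hS
  have hKn' : (2 : ℤ) ^ n = K * (cutCode S).card := by exact_mod_cast hKn
  have hK' : (0 : ℤ) < K := by exact_mod_cast hK
  rw [hsum, sum_cutWeight hS, hKn']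
  rcases Nat.even_or_odd S.card with hev | hodd
  · obtain ⟨h1, h2⟩ := h.even_bound hev
    rw [hev.neg_one_pow]
    refine ⟨?_, fun ⟨T, hTS, hT⟩ _ => ?_⟩
    · zify at h1
      nlinarith
    · have h3 := h2 fun hfull => by
        obtain ⟨e, he⟩ : T.Nonempty := card_pos.1 (by rw [hT.card_eq]; norm_num)
        have h4 : {e} ∈ cutCode S := by simp [hfull, hTS he]
        obtain ⟨X, -, hX⟩ := mem_image.1 h4
        have h5 := hT.even_card_inter_cut X
        rw [← inter_eq_left.2 hTS, inter_assoc, hX, inter_singleton_of_mem he,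
          card_singleton] at h5
        exact absurd h5 (by decide)
      zify at h3
      nlinarith
  · obtain ⟨h1, h2⟩ := h.odd_bound hodd
    rw [hodd.neg_one_pow]
    refine ⟨?_, fun _ h3 => ?_⟩
    · zify at h1
      nlinarith
    · have h4 := h2 h3
      zify at h4
      nlinarith

lemma card_edgeFinset (n : ℕ) : (edgeFinset n).card = n.choose 2 := by
  rw [edgeFinset, ← Fintype.card_subtype, Sym2.card_subtype_not_diag, Fintype.card_fin]

lemma TriangleIntersecting.symmDiff_inter_ne {F : Finset (Finset (Sym2 (Fin n)))}
    (hF : F ⊆ (edgeFinset n).powerset) (hInt : TriangleIntersecting F) (X : Finset (Fin n))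
    {G H : Finset (Sym2 (Fin n))} (hG : G ∈ F) (hH : H ∈ F) {B : Finset (Sym2 (Fin n))}
    (hB : B ⊆ cut X) : symmDiff G H ∩ edgeFinset n ≠ edgeFinset n \ B := by
  intro h
  obtain ⟨T, hT, hTGH⟩ := hInt G hG H hH
  refine hT.not_subset_cut X fun e he => hB ?_
  have h1 := mem_inter.1 (hTGH he)
  have h2 : e ∈ edgeFinset n := mem_powerset.1 (hF hG) h1.1
  by_contra heB
  have h3 : e ∈ edgeFinset n \ B := mem_sdiff.2 ⟨h2, heB⟩
  rw [← h, mem_inter, mem_symmDiff] at h3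
  tauto

/-- The Fourier transform of an extremal family vanishes at all graphs with more than three edges
that contain a triangle. -/
lemma TriangleIntersecting.fourierSum_eq_zero {F : Finset (Finset (Sym2 (Fin n)))}
    (hF : F ⊆ (edgeFinset n).powerset) (hInt : TriangleIntersecting F)
    (hcard : 8 * F.card = 2 ^ (edgeFinset n).card) {S : Finset (Sym2 (Fin n))}
    (hS : S ⊆ edgeFinset n) (hTS : ∃ T ⊆ S, IsTriangle T) (hS3 : 3 < S.card) :
    fourierSum F S = 0 := by
  set w : Finset (Sym2 (Fin n)) → ℤ := fun S =>
    8 * 2 ^ n + (-1) ^ S.card * ∑ X : Finset (Fin n), cutWeight (S ∩ cut X) with hw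
  have h1 : ∑ S ∈ (edgeFinset n).powerset, w S * fourierSum F S ^ 2 =
      8 * 2 ^ n * (F.card * 2 ^ (edgeFinset n).card) := by
    rw [← sum_fourierSum_sq hF, mul_sum]
    have h2 : ∑ S ∈ (edgeFinset n).powerset,
        ((-1) ^ S.card * ∑ X : Finset (Fin n), cutWeight (S ∩ cut X)) *
          fourierSum F S ^ 2 = 0 := by
      simp only [mul_sum, sum_mul]
      rw [sum_comm]
      exact sum_eq_zero fun X _ => sum_trace_mul_fourierSum_sq
        (fun G hG H hH B hB => hInt.symmDiff_inter_ne hF X hG hH hB) cutWeight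
    simp only [hw, add_mul, sum_add_distrib, h2, add_zero]
  have h0 : w ∅ * fourierSum F ∅ ^ 2 = 8 * 2 ^ n * (F.card * 2 ^ (edgeFinset n).card) := by
    have h3 : (8 * F.card : ℤ) = 2 ^ (edgeFinset n).card := by exact_mod_cast hcard
    simp only [hw, fourierSum_empty, cutWeight, ← h3]
    simp
    ring
  have h4 := add_sum_erase (edgeFinset n).powerset (fun S => w S * fourierSum F S ^ 2)
    (empty_mem_powerset _)
  rw [h1, h0] at h4
  have h5 : ∑ S ∈ (edgeFinset n).powerset.erase ∅, w S * fourierSum F S ^ 2 = 0 := by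
    linarith
  have h6 := (sum_eq_zero_iff_of_nonneg fun S hS => mul_nonneg
    (signed_sum_cutWeight (mem_powerset.1 (mem_of_mem_erase hS))).1 (sq_nonneg _)).1 h5 S
    (mem_erase.2 ⟨by rintro rfl; simp at hS3, mem_powerset.2 hS⟩)
  have h7 := (signed_sum_cutWeight hS).2 hTS hS3
  exact pow_eq_zero_iff two_ne_zero |>.1 ((mul_eq_zero.1 h6).resolve_left h7.ne')

lemma card_filter_subset_powerset {α : Type*} [DecidableEq α] {T U : Finset α} (hTU : T ⊆ U) :
    (U.powerset.filter (fun G => T ⊆ G)).card = 2 ^ (U.card - T.card) := by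
  rw [← card_sdiff_of_subset hTU, ← card_powerset]
  refine card_nbij' (fun G => G \ T) (fun G => G ∪ T) ?_ ?_ ?_ ?_
  · intro G hG
    simp only [coe_filter, mem_powerset, Set.mem_ofPred_eq, coe_powerset, Set.mem_preimage] at *
    exact_mod_cast sdiff_subset_sdiff hG.1 subset_rfl
  · intro G hG
    rw [mem_coe, mem_powerset] at hG
    simp only [coe_filter, mem_powerset, Set.mem_ofPred_eq]
    exact ⟨union_subset (hG.trans sdiff_subset) hTU, subset_union_right⟩
  · intro G hG
    simp only [coe_filter, mem_powerset, Set.mem_ofPred_eq] at hG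
    exact sdiff_union_of_subset hG.2
  · intro G hG
    rw [mem_coe, mem_powerset] at hG
    exact union_sdiff_cancel_right (disjoint_of_subset_left hG sdiff_disjoint)

end Cuts

theorem triangle_intersecting_extremal
    (n : ℕ) (hn : 3 ≤ n)
    (F : Finset (Finset (Sym2 (Fin n))))
    (hF : F ⊆ (edgeFinset n).powerset)
    (hInt : TriangleIntersecting F)
    (hcard : (F.card : ℝ) = (1 / 8) * 2 ^ (n.choose 2)) :
    ∃ T : Finset (Sym2 (Fin n)), IsTriangle T ∧
      F = (edgeFinset n).powerset.filter (fun G => T ⊆ G) := by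
  have hcard' : 8 * F.card = 2 ^ (edgeFinset n).card := by
    have h1 : (8 * F.card : ℝ) = 2 ^ (edgeFinset n).card := by
      rw [hcard, card_edgeFinset]
      ring
    exact_mod_cast h1
  have hne : F.Nonempty := by
    rw [← Finset.card_pos]
    have : 0 < 2 ^ (edgeFinset n).card := by positivity
    omega
  obtain ⟨M, hM, hmin⟩ := Finset.exists_min_image F Finset.card hne
  obtain ⟨S, hMS, hSU, hS⟩ := exists_superset_fourierSum_ne_zero hF hM fun G hG hGM =>
    Finset.eq_of_subset_of_card_le hGM (hmin G hG)
  obtain ⟨T, hT, hTM⟩ := hInt M hM M hM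
  rw [Finset.inter_self] at hTM
  have hS3 : S.card ≤ 3 := by
    by_contra! h3
    exact hS (hInt.fourierSum_eq_zero hF hcard' hSU ⟨T, hTM.trans hMS, hT⟩ h3)
  have hTM' : T = M := Finset.eq_of_subset_of_card_le hTM <| by
    rw [hT.card_eq]
    exact (Finset.card_le_card hMS).trans hS3
  subst hTM'
  refine ⟨T, hT, Finset.eq_of_subset_of_card_le ?_ ?_⟩
  · intro G hG
    obtain ⟨T', hT', hTG⟩ := hInt T hM G hG
    have h1 : T' = T := Finset.eq_of_subset_of_card_le
      (hTG.trans Finset.inter_subset_left) (by rw [hT.card_eq, hT'.card_eq])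
    exact Finset.mem_filter.2 ⟨hF hG, h1 ▸ hTG.trans Finset.inter_subset_right⟩
  · have h1 : T ⊆ edgeFinset n := Finset.mem_powerset.1 (hF hM)
    have h2 := Finset.card_le_card h1
    rw [card_filter_subset_powerset h1, hT.card_eq]
    rw [hT.card_eq] at h2
    obtain ⟨m, hm⟩ := Nat.exists_eq_add_of_le h2
    rw [hm, pow_add] at hcard'
    rw [hm, Nat.add_sub_cancel_left]
    omega
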